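/- Let N and d be positive integers with d ≤ N and gcd(d, N) = 1. Then for every k ∈ ZMod N, the Dirichlet-kernel sum Σ_{m=0}^{d−1} exp(−2πi·k·m/N) is nonzero; equivalently, the indicator function of {0, …, d−1} on ZMod N has non-vanishing DFT. -/

import Mathlib

open Complex Finset

/-- The character `t ↦ exp(-2πi t.val / N)` on `ZMod N`. -/
noncomputable def char (N : ℕ) (t : ZMod N) : ℂ :=
  Complex.exp (-2 * Real.pi * Complex.I * (t.val : ℂ) / N)

/-- The short-time Fourier transform (L = 1) of `x` with window `g`. -/
noncomputable def STFT (N : ℕ) [NeZero N] (x g : ZMod N → ℂ) (m k : ZMod N) : ℂ :=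
  ∑ n : ZMod N, x n * g (m - n) * char N (k * n)

/-- The discrete Fourier transform of `h : ZMod N → ℂ`. -/
noncomputable def DFT (N : ℕ) [NeZero N] (h : ZMod N → ℂ) (k : ZMod N) : ℂ :=
  ∑ m : ZMod N, h m * char N (k * m)

/-- The rectangular window of length `W` on `ZMod N`. -/
noncomputable def rectWindow (N W : ℕ) : ZMod N → ℂ :=
  fun n => if n.val < W then 1 else 0

theorem char_eq_stdAddChar_neg (N : ℕ) [NeZero N] (t : ZMod N) :
    char N t = ZMod.stdAddChar (-t) := by
  have h := ZMod.stdAddChar_coe (N := N) (-(t.val : ℤ))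
  rw [show ((-(t.val : ℤ) : ℤ) : ZMod N) = -t by simp] at h
  rw [h, char]
  congr 1
  push_cast
  ring

theorem sum_range_char_mul_ne_zero {N d : ℕ} [NeZero N] (hd : 0 < d) (hcop : Nat.gcd d N = 1)
    (k : ZMod N) : ∑ m ∈ Finset.range d, char N (k * (m : ZMod N)) ≠ 0 := by
  have hpow (m : ℕ) : char N (k * (m : ZMod N)) = ZMod.stdAddChar (-k) ^ m := by
    rw [char_eq_stdAddChar_neg, ← AddChar.map_nsmul_eq_pow, nsmul_eq_mul]
    congr 1
    ring
  simp only [hpow]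
  intro h
  have hone : ZMod.stdAddChar (-k) ^ d = (1 : ℂ) := by
    rw [← sub_eq_zero, ← geom_sum_mul, h, zero_mul]
  rw [← AddChar.map_nsmul_eq_pow, ← (ZMod.stdAddChar (N := N)).map_zero_eq_one,
    ZMod.injective_stdAddChar.eq_iff, nsmul_eq_mul] at hone
  have hk : -k = 0 := ((ZMod.isUnit_iff_coprime d N).mpr hcop).mul_right_eq_zero.mp hone
  rw [hk] at h
  simp at h
  omega

theorem DFT_indicator_val_lt {N d : ℕ} [NeZero N] (hdN : d ≤ N) (k : ZMod N) :
    DFT N (fun n => if n.val < d then 1 else 0) k =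
      ∑ m ∈ Finset.range d, char N (k * (m : ZMod N)) := by
  simp only [DFT, ite_mul, one_mul, zero_mul]
  rw [← Finset.sum_filter]
  refine Finset.sum_nbij' ZMod.val (fun m => (m : ZMod N)) ?_ ?_ ?_ ?_ ?_
  · simp
  · intro m hm
    rw [Finset.mem_range] at hm
    simpa [ZMod.val_cast_of_lt (hm.trans_le hdN)] using hm
  · simp
  · intro m hm
    exact ZMod.val_cast_of_lt ((Finset.mem_range.mp hm).trans_le hdN)
  · simp

theorem stmt_10 (N d : ℕ) [NeZero N] (hd : 0 < d) (hdN : d ≤ N) (hcop : Nat.gcd d N = 1) :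
    (∀ k : ZMod N, ∑ m ∈ Finset.range d, char N (k * (m : ZMod N)) ≠ 0) ∧
    (∀ k : ZMod N, DFT N (fun n => if n.val < d then 1 else 0) k ≠ 0) := by
  refine ⟨sum_range_char_mul_ne_zero hd hcop, fun k => ?_⟩
  rw [DFT_indicator_val_lt hdN]
  exact sum_range_char_mul_ne_zero hd hcop k
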